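/- Let n and n′ be natural numbers, h₁ = 2/√n, h₂ = 2/√n′, X₁ = { h₁(k − n/2) : k = 0,1,…,n } and X₂ = { h₂(k − n′/2) : k = 0,1,…,n′ }. Let A be a strictly positive definite 3×3 real matrix and, for x = (x₁,x₂,x₃)ᵀ, define I_d = ∫_{−∞}^{∞} h₁h₂·Σ_{x₁∈X₁}Σ_{x₂∈X₂} exp{−xᵀA x/2} dx₃ and I_c = ∫_{ℝ³} exp{−xᵀA x/2} dx. Then I_d ≤ (1 + ηA₁₁/n)(1 + ηA₂₂/n′)·I_c, where A_{ii} are the diagonal entries of A and η = √(9/(8πe)). -/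

import Mathlib

open Matrix

/-- `η = √(9/(8πe))`. -/
noncomputable def eta : ℝ := Real.sqrt (9 / (8 * Real.pi * Real.exp 1))

open MeasureTheory in
/-- Integrating a translated Gaussian with an additive constant in the exponent. -/
lemma integral_exp_neg_half_add_mul_sq (w c d : ℝ) :
    ∫ x : ℝ, Real.exp (-(c + w * (x + d) ^ 2) / 2) =
      Real.exp (-c / 2) * √(2 * Real.pi / w) := by
  have h : ∀ x : ℝ, Real.exp (-(c + w * (x + d) ^ 2) / 2) =
      Real.exp (-c / 2) * Real.exp (-(w / 2) * (x + d) ^ 2) := fun x => by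
    rw [← Real.exp_add]; ring_nf
  simp_rw [h]
  rw [integral_const_mul, integral_add_right_eq_self (fun x => Real.exp (-(w / 2) * x ^ 2)) d,
    integral_gaussian]
  congr 2
  rw [div_div_eq_mul_div, mul_comm]

lemma integrable_exp_neg_half_add_mul_sq {w : ℝ} (hw : 0 < w) (c d : ℝ) :
    MeasureTheory.Integrable fun x : ℝ => Real.exp (-(c + w * (x + d) ^ 2) / 2) := by
  have h : ∀ x : ℝ, Real.exp (-(c + w * (x + d) ^ 2) / 2) =
      Real.exp (-c / 2) * Real.exp (-(w / 2) * (x + d) ^ 2) := fun x => by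
    rw [← Real.exp_add]; ring_nf
  simp_rw [h]
  exact ((integrable_exp_neg_mul_sq (half_pos hw)).comp_add_right d).const_mul _

lemma summable_exp_neg_mul_int_add_sq {b : ℝ} (hb : 0 < b) (c : ℝ) :
    Summable fun k : ℤ => Real.exp (-Real.pi * b * (k + c) ^ 2) := by
  have h := ((summable_jacobiTheta₂_term_iff (Complex.I * (b * c : ℝ)) (Complex.I * b)).2
    (by simpa using hb)).norm.mul_left (Real.exp (-Real.pi * b * c ^ 2))
  refine h.congr fun k => ?_
  rw [norm_jacobiTheta₂_term, ← Real.exp_add]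
  congr 1
  simp
  ring

lemma tsum_exp_neg_mul_int_sq_le {a : ℝ} (ha : 0 < a) :
    ∑' k : ℤ, Real.exp (-Real.pi * a * k ^ 2) ≤ 1 + Real.pi / (3 * Real.exp 1 * a) := by
  have hsum : Summable fun k : ℤ => Real.exp (-Real.pi * a * k ^ 2) := by
    simpa using summable_exp_neg_mul_int_add_sq ha 0
  have hzeta : HasSum (fun n : ℕ => 1 / ((n : ℝ) + 1) ^ 2) (Real.pi ^ 2 / 6) := by
    have := (hasSum_nat_add_iff' 1).2 hasSum_zeta_two
    simpa using this
  have hz := hzeta.mul_left (1 / (Real.exp 1 * Real.pi * a))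
  have key : ∀ n : ℕ, Real.exp (-Real.pi * a * ((n : ℝ) + 1) ^ 2) ≤
      1 / (Real.exp 1 * Real.pi * a) * (1 / ((n : ℝ) + 1) ^ 2) := fun n => by
    set y := Real.pi * a * ((n : ℝ) + 1) ^ 2 with hy
    have hy0 : 0 < y := by positivity
    have h1 : Real.exp 1 * y ≤ Real.exp y := by
      have := Real.add_one_le_exp (y - 1)
      rw [Real.exp_sub, le_div_iff₀ (Real.exp_pos 1)] at this
      linarith
    calc Real.exp (-Real.pi * a * ((n : ℝ) + 1) ^ 2) = (Real.exp y)⁻¹ := by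
          rw [← Real.exp_neg, hy]; ring_nf
      _ ≤ (Real.exp 1 * y)⁻¹ := by gcongr
      _ = _ := by rw [hy]; field_simp
  have hs1 : Summable fun n : ℕ => Real.exp (-Real.pi * a * ((n : ℝ) + 1) ^ 2) :=
    Summable.of_nonneg_of_le (fun _ => (Real.exp_pos _).le) key hz.summable
  have hle := hs1.tsum_le_tsum key hz.summable
  rw [hz.tsum_eq] at hle
  have hsplit : ∑' k : ℤ, Real.exp (-Real.pi * a * k ^ 2) =
      ∑' n : ℕ, Real.exp (-Real.pi * a * ((n : ℝ) + 1) ^ 2) + 1 +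
        ∑' n : ℕ, Real.exp (-Real.pi * a * ((n : ℝ) + 1) ^ 2) := by
    have e : ∀ n : ℕ, (((-((n : ℤ) + 1) : ℤ) : ℝ)) ^ 2 = ((n : ℝ) + 1) ^ 2 := fun n => by
      push_cast; ring
    rw [tsum_of_add_one_of_neg_add_one (f := fun k : ℤ => Real.exp (-Real.pi * a * k ^ 2))]
    · simp only [e]
      simp
    · simpa using hs1
    · simpa only [e] using hs1
  have : 1 / (Real.exp 1 * Real.pi * a) * (Real.pi ^ 2 / 6) * 2 =
      Real.pi / (3 * Real.exp 1 * a) := by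
    field_simp; norm_num
  linarith

lemma tsum_exp_neg_mul_int_add_sq_le {b : ℝ} (hb : 0 < b) (c : ℝ) :
    ∑' k : ℤ, Real.exp (-Real.pi * b * (k + c) ^ 2) ≤
      (1 + Real.pi * b / (3 * Real.exp 1)) / √b := by
  have hP := Complex.tsum_exp_neg_quadratic (a := ((b⁻¹ : ℝ) : ℂ)) (by simpa using hb)
    (-Complex.I * c)
  have hR : ∑' n : ℤ, Complex.exp (-Real.pi / ((b⁻¹ : ℝ) : ℂ) * (n + Complex.I * (-Complex.I * c)) ^ 2)
      = ((∑' k : ℤ, Real.exp (-Real.pi * b * (k + c) ^ 2) : ℝ) : ℂ) := by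
    rw [Complex.ofReal_tsum]
    refine tsum_congr fun k => ?_
    have : Complex.I * (-Complex.I * c) = c := by
      linear_combination (-(c : ℂ)) * Complex.I_mul_I
    rw [this]
    push_cast
    rw [div_inv_eq_mul]
  have hsq : ((b⁻¹ : ℝ) : ℂ) ^ (1 / 2 : ℂ) = ((√b)⁻¹ : ℝ) := by
    rw [← Real.sqrt_inv, Real.sqrt_eq_rpow, Complex.ofReal_cpow (by positivity)]
    norm_num
  have hnorm : ∀ n : ℤ, ‖Complex.exp (-Real.pi * ((b⁻¹ : ℝ) : ℂ) * n ^ 2 +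
      2 * Real.pi * (-Complex.I * c) * n)‖ = Real.exp (-Real.pi * b⁻¹ * n ^ 2) := fun n => by
    rw [Complex.norm_exp]
    congr 1
    have : (-Real.pi * ((b⁻¹ : ℝ) : ℂ) * n ^ 2 + 2 * Real.pi * (-Complex.I * c) * n : ℂ) =
        ((-Real.pi * b⁻¹ * n ^ 2 : ℝ) : ℂ) + ((-2 * Real.pi * c * n : ℝ) : ℂ) * Complex.I := by
      push_cast; ring
    rw [this]
    simp [-Complex.ofReal_mul, -Complex.ofReal_neg]
  rw [hR, hsq] at hP
  have hsum : Summable fun k : ℤ => Real.exp (-Real.pi * b⁻¹ * k ^ 2) := by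
    simpa using summable_exp_neg_mul_int_add_sq (inv_pos.2 hb) 0
  have h1 := norm_tsum_le_tsum_norm (f := fun n : ℤ =>
    Complex.exp (-Real.pi * ((b⁻¹ : ℝ) : ℂ) * n ^ 2 + 2 * Real.pi * (-Complex.I * c) * n))
    (by simpa only [hnorm] using hsum)
  simp only [hnorm] at h1
  rw [hP] at h1
  have h2 := h1.trans (tsum_exp_neg_mul_int_sq_le (inv_pos.2 hb))
  have h3 : 0 ≤ ∑' k : ℤ, Real.exp (-Real.pi * b * (k + c) ^ 2) :=
    tsum_nonneg fun _ => (Real.exp_pos _).le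
  have hb' : 0 < √b := Real.sqrt_pos.2 hb
  rw [norm_mul, Complex.norm_real, Real.norm_of_nonneg h3, norm_div, norm_one, Complex.norm_real,
    Real.norm_of_nonneg (by positivity), one_div, inv_inv] at h2
  rw [le_div_iff₀ hb', mul_comm]
  convert h2 using 2
  field_simp

lemma two_div_three_exp_one_le_eta : 2 / (3 * Real.exp 1) ≤ eta := by
  unfold eta
  apply Real.le_sqrt_of_sq_le
  have h1 := Real.exp_one_gt_d9
  have h2 := Real.pi_lt_d2
  have h3 := Real.pi_pos
  rw [div_pow, div_le_div_iff₀ (by positivity) (by positivity)]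
  nlinarith [Real.exp_pos 1]

lemma eta_nonneg : 0 ≤ eta := Real.sqrt_nonneg _

/-- One-dimensional comparison of a translated Gaussian Riemann sum with the integral. -/
lemma sum_exp_neg_half_mul_sq_le {n : ℕ} (hn : 0 < n) {r : ℝ} (hr : 0 < r) (d : ℝ) :
    (2 / √n) * ∑ k ∈ Finset.range (n + 1),
        Real.exp (-(r * ((2 / √n) * ((k : ℝ) - (n : ℝ) / 2) + d) ^ 2) / 2) ≤
      (1 + eta * r / n) * √(2 * Real.pi / r) := by
  have hn' : (0 : ℝ) < n := by exact_mod_cast hn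
  set h : ℝ := 2 / √n with hh
  have hpos : 0 < h := by positivity
  have hsq : h ^ 2 = 4 / n := by rw [hh, div_pow, Real.sq_sqrt hn'.le]; norm_num
  set b : ℝ := r * h ^ 2 / (2 * Real.pi) with hb
  have hb0 : 0 < b := by positivity
  set c : ℝ := -(n : ℝ) / 2 + d / h with hc
  have hterm : ∀ k : ℕ, Real.exp (-(r * (h * ((k : ℝ) - (n : ℝ) / 2) + d) ^ 2) / 2) =
      Real.exp (-Real.pi * b * (((k : ℤ) : ℝ) + c) ^ 2) := fun k => by
    congr 1
    rw [hb, hc]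
    push_cast
    field_simp
    ring
  have hle : ∑ k ∈ Finset.range (n + 1),
      Real.exp (-(r * (h * ((k : ℝ) - (n : ℝ) / 2) + d) ^ 2) / 2) ≤
      (1 + Real.pi * b / (3 * Real.exp 1)) / √b := by
    refine le_trans ?_ (tsum_exp_neg_mul_int_add_sq_le hb0 c)
    simp only [hterm]
    rw [← Finset.sum_image (s := Finset.range (n + 1)) (g := fun k : ℕ => (k : ℤ))
      (f := fun k : ℤ => Real.exp (-Real.pi * b * ((k : ℝ) + c) ^ 2))
      (fun _ _ _ _ e => Int.ofNat_inj.1 e)]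
    exact (summable_exp_neg_mul_int_add_sq hb0 c).sum_le_tsum _
      fun _ _ => (Real.exp_pos _).le
  have hsb : h / √b = √(2 * Real.pi / r) := by
    have : 2 * Real.pi / r = h ^ 2 / b := by rw [hb]; field_simp
    rw [this, Real.sqrt_div (sq_nonneg h) b, Real.sqrt_sq hpos.le]
  have hcoef : Real.pi * b / (3 * Real.exp 1) ≤ eta * r / n := by
    have : Real.pi * b / (3 * Real.exp 1) = 2 / (3 * Real.exp 1) * r / n := by
      rw [hb, hsq]; field_simp; norm_num
    rw [this]
    have := two_div_three_exp_one_le_eta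
    gcongr
  calc _ ≤ h * ((1 + Real.pi * b / (3 * Real.exp 1)) / √b) := by gcongr
    _ = (1 + Real.pi * b / (3 * Real.exp 1)) * √(2 * Real.pi / r) := by rw [← hsb]; ring
    _ ≤ _ := by gcongr

/-- Completing the squares in a positive definite ternary quadratic form. -/
lemma Matrix.PosDef.exists_sum_squares_fin_three {A : Matrix (Fin 3) (Fin 3) ℝ} (hA : A.PosDef) :
    ∃ t r w m u v : ℝ, 0 < t ∧ 0 < r ∧ 0 < w ∧ t ≤ A 0 0 ∧ r ≤ A 1 1 ∧
      ∀ x1 x2 x3 : ℝ, ![x1, x2, x3] ⬝ᵥ (A *ᵥ ![x1, x2, x3]) =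
        t * x1 ^ 2 + r * (x2 + m * x1) ^ 2 + w * (x3 + (u * x1 + v * x2)) ^ 2 := by
  have h10 : A 1 0 = A 0 1 := by simpa using hA.isHermitian.apply 0 1
  have h20 : A 2 0 = A 0 2 := by simpa using hA.isHermitian.apply 0 2
  have h21 : A 2 1 = A 1 2 := by simpa using hA.isHermitian.apply 1 2
  have hQ : ∀ x1 x2 x3 : ℝ, ![x1, x2, x3] ⬝ᵥ (A *ᵥ ![x1, x2, x3]) =
      A 0 0 * x1 ^ 2 + A 1 1 * x2 ^ 2 + A 2 2 * x3 ^ 2 + 2 * A 0 1 * x1 * x2 +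
        2 * A 0 2 * x1 * x3 + 2 * A 1 2 * x2 * x3 := fun x1 x2 x3 => by
    simp [dotProduct, mulVec, Fin.sum_univ_three, h10, h20, h21]
    ring
  have hpos : ∀ x1 x2 x3 : ℝ, ![x1, x2, x3] ≠ 0 →
      0 < ![x1, x2, x3] ⬝ᵥ (A *ᵥ ![x1, x2, x3]) := fun x1 x2 x3 hx => by
    simpa using hA.dotProduct_mulVec_pos hx
  have hw : 0 < A 2 2 := by
    have := hpos 0 0 1 fun h => by simpa using congrFun h 2
    rw [hQ] at this
    linarith
  have hr : 0 < A 1 1 - A 1 2 ^ 2 / A 2 2 := by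
    have := hpos 0 1 (-(A 1 2 / A 2 2)) fun h => by simpa using congrFun h 1
    rw [hQ] at this
    convert this using 1
    field_simp
    ring
  obtain ⟨r, hrdef⟩ : ∃ r, r = A 1 1 - A 1 2 ^ 2 / A 2 2 := ⟨_, rfl⟩
  rw [← hrdef] at hr
  set v := A 1 2 / A 2 2 with hv
  set u := A 0 2 / A 2 2 with hu
  set m := (A 0 1 - A 0 2 * A 1 2 / A 2 2) / r with hm
  have e02 : A 0 2 = A 2 2 * u := by rw [hu]; field_simp
  have e12 : A 1 2 = A 2 2 * v := by rw [hv]; field_simp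
  have e11 : A 1 1 = r + A 2 2 * v ^ 2 := by rw [hrdef, hv]; field_simp; ring
  have e01 : A 0 1 = r * m + A 2 2 * u * v := by rw [hm, hu, hv]; field_simp; ring
  have hsq : ∀ x1 x2 x3 : ℝ, ![x1, x2, x3] ⬝ᵥ (A *ᵥ ![x1, x2, x3]) =
      (A 0 0 - r * m ^ 2 - A 2 2 * u ^ 2) * x1 ^ 2 + r * (x2 + m * x1) ^ 2 +
        A 2 2 * (x3 + (u * x1 + v * x2)) ^ 2 := fun x1 x2 x3 => by
    rw [hQ, e02, e12, e11, e01]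
    ring
  refine ⟨A 0 0 - r * m ^ 2 - A 2 2 * u ^ 2, r, A 2 2, m, u, v, ?_, hr, hw, ?_, ?_, hsq⟩
  · have := hpos 1 (-m) (-(u + v * -m)) fun h => by simpa using congrFun h 0
    rw [hsq] at this
    convert this using 1
    ring
  · have : 0 ≤ r * m ^ 2 := by positivity
    have : 0 ≤ A 2 2 * u ^ 2 := by positivity
    linarith
  · have : 0 ≤ A 2 2 * v ^ 2 := by positivity
    linarith

/-- Three-dimensional Riemann-sum comparison (Takeishi–Takeuchi 2019): with
`h₁ = 2/√n`, `h₂ = 2/√n′`, `X₁ = {h₁(k − n/2)}`, `X₂ = {h₂(k − n′/2)}` and a strictly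
positive definite `3×3` matrix `A`,
`I_d = ∫ h₁h₂·Σ_{x₁∈X₁}Σ_{x₂∈X₂} exp{−xᵀAx/2} dx₃ ≤ (1 + ηA₁₁/n)(1 + ηA₂₂/n′)·I_c`
where `I_c = ∫_{ℝ³} exp{−xᵀAx/2} dx`. -/
theorem stmt_7 (n n' : ℕ) (hn : 0 < n) (hn' : 0 < n')
    (A : Matrix (Fin 3) (Fin 3) ℝ) (hA : A.PosDef) :
    (∫ x3 : ℝ, (2 / Real.sqrt n) * (2 / Real.sqrt n') *
      ∑ k ∈ Finset.range (n + 1), ∑ k' ∈ Finset.range (n' + 1),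
        Real.exp (-(![(2 / Real.sqrt n) * ((k : ℝ) - (n : ℝ) / 2),
                     (2 / Real.sqrt n') * ((k' : ℝ) - (n' : ℝ) / 2), x3] ⬝ᵥ
          (A *ᵥ ![(2 / Real.sqrt n) * ((k : ℝ) - (n : ℝ) / 2),
                  (2 / Real.sqrt n') * ((k' : ℝ) - (n' : ℝ) / 2), x3])) / 2))
      ≤ (1 + eta * A 0 0 / n) * (1 + eta * A 1 1 / n') *
        ∫ x1 : ℝ, ∫ x2 : ℝ, ∫ x3 : ℝ,
          Real.exp (-(![x1, x2, x3] ⬝ᵥ (A *ᵥ ![x1, x2, x3])) / 2) := by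
  obtain ⟨t, r, w, m, u, v, ht, hr, hw, htA, hrA, hQ⟩ := hA.exists_sum_squares_fin_three
  have hη := eta_nonneg
  simp only [hQ]
  rw [MeasureTheory.integral_const_mul, MeasureTheory.integral_finsetSum _ fun k _ =>
    MeasureTheory.integrable_finsetSum _ fun k' _ => integrable_exp_neg_half_add_mul_sq hw _ _]
  simp only [MeasureTheory.integral_finsetSum _ fun k' _ =>
    integrable_exp_neg_half_add_mul_sq hw _ _, integral_exp_neg_half_add_mul_sq,
    MeasureTheory.integral_mul_const]
  have h1 : ∫ x : ℝ, Real.exp (-(t * x ^ 2) / 2) = √(2 * Real.pi / t) := by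
    simpa using integral_exp_neg_half_add_mul_sq t 0 0
  rw [h1]
  have hsplit : ∀ p q : ℝ, Real.exp (-(p + q) / 2) = Real.exp (-p / 2) * Real.exp (-q / 2) :=
    fun p q => by rw [← Real.exp_add]; ring_nf
  simp only [hsplit, ← Finset.sum_mul, ← Finset.mul_sum]
  set x : ℕ → ℝ := fun k => (2 / √n) * ((k : ℝ) - (n : ℝ) / 2) with hx
  have inner : ∀ k : ℕ, (2 / √n') * ∑ k' ∈ Finset.range (n' + 1),
      Real.exp (-(r * ((2 / √n') * ((k' : ℝ) - (n' : ℝ) / 2) + m * x k) ^ 2) / 2) ≤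
      (1 + eta * A 1 1 / n') * √(2 * Real.pi / r) := fun k =>
    (sum_exp_neg_half_mul_sq_le hn' hr _).trans (by gcongr)
  have outer : (2 / √n) * ∑ k ∈ Finset.range (n + 1), Real.exp (-(t * x k ^ 2) / 2) ≤
      (1 + eta * A 0 0 / n) * √(2 * Real.pi / t) := by
    have := sum_exp_neg_half_mul_sq_le hn ht 0
    simp only [add_zero] at this
    exact this.trans (by gcongr)
  have hA11 : 0 ≤ A 1 1 := hr.le.trans hrA
  calc _ = (2 / √n) * (∑ k ∈ Finset.range (n + 1), Real.exp (-(t * x k ^ 2) / 2) *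
        ((2 / √n') * ∑ k' ∈ Finset.range (n' + 1),
          Real.exp (-(r * ((2 / √n') * ((k' : ℝ) - (n' : ℝ) / 2) + m * x k) ^ 2) / 2))) *
        √(2 * Real.pi / w) := by
        simp only [mul_left_comm _ (2 / √n'), ← Finset.mul_sum]
        ring
    _ ≤ (2 / √n) * (∑ k ∈ Finset.range (n + 1), Real.exp (-(t * x k ^ 2) / 2) *
        ((1 + eta * A 1 1 / n') * √(2 * Real.pi / r))) * √(2 * Real.pi / w) := by
        exact mul_le_mul_of_nonneg_right (mul_le_mul_of_nonneg_left
          (Finset.sum_le_sum fun k _ => mul_le_mul_of_nonneg_left (inner k) (Real.exp_pos _).le)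
          (by positivity)) (Real.sqrt_nonneg _)
    _ = ((2 / √n) * ∑ k ∈ Finset.range (n + 1), Real.exp (-(t * x k ^ 2) / 2)) *
        ((1 + eta * A 1 1 / n') * √(2 * Real.pi / r)) * √(2 * Real.pi / w) := by
        rw [← Finset.sum_mul]; ring
    _ ≤ ((1 + eta * A 0 0 / n) * √(2 * Real.pi / t)) *
        ((1 + eta * A 1 1 / n') * √(2 * Real.pi / r)) * √(2 * Real.pi / w) := by
        gcongr
    _ = _ := by ring
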